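/- arXiv:2207.04232 — 2 statements merged into one kernel-verified Lean document; each statement's English description precedes it below -/
import Mathlib

section
/- Let q = r^{sm} where r is an odd prime power, m is an odd positive integer, and s is a positive integer. Let t be an odd integer dividing r−1, and let e be an integer with 0 ≤ e ≤ s−1. If η((−1)^{(r^e+1)/2}·t) = 1, then there exists an MDS self-dual code over F_q of length t·r^e·(1 + r^s + r^{2s} + ⋯ + r^{s(m−1)}) + 1. -/
open Finset

/-- The Euclidean dual of a linear code `C ⊆ F^n`. -/
def euclideanDual {F : Type*} [Field F] {n : ℕ} (C : Submodule F (Fin n → F)) :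
    Submodule F (Fin n → F) where
  carrier := {x | ∀ c ∈ C, ∑ i, x i * c i = 0}
  add_mem' := by
    intro a b ha hb c hc
    have h : ∑ i, (a + b) i * c i = (∑ i, a i * c i) + ∑ i, b i * c i := by
      rw [← Finset.sum_add_distrib]
      exact Finset.sum_congr rfl fun i _ => by simp [add_mul]
    simp only [Set.mem_setOf_eq] at *
    rw [h, ha c hc, hb c hc, add_zero]
  zero_mem' := by
    intro c hc
    simp
  smul_mem' := by
    intro r a ha c hc
    have h : ∑ i, (r • a) i * c i = r * ∑ i, a i * c i := by
      rw [Finset.mul_sum]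
      exact Finset.sum_congr rfl fun i _ => by simp [mul_assoc]
    simp only [Set.mem_setOf_eq] at *
    rw [h, ha c hc, mul_zero]

/-- Hamming weight of a word. -/
noncomputable def hWeight {F : Type*} [Field F] {n : ℕ} (c : Fin n → F) : ℕ := Nat.card {i : Fin n // c i ≠ 0}

/-- `C` is an MDS (Euclidean) self-dual code: it equals its Euclidean dual and its
minimum Hamming distance is `n/2 + 1`. -/
def IsMDSSelfDual {F : Type*} [Field F] {n : ℕ} (C : Submodule F (Fin n → F)) : Prop :=
  C = euclideanDual C ∧
  (∀ c ∈ C, c ≠ 0 → n / 2 + 1 ≤ hWeight c) ∧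
  (∃ c ∈ C, c ≠ 0 ∧ hWeight c = n / 2 + 1)

open Classical in
/-- The quadratic character `η` of a field: `1` on nonzero squares, `-1` on nonsquares,
`0` at `0`. -/
noncomputable def quadChar (F : Type*) [Field F] (x : F) : ℤ :=
  if x = 0 then 0 else if IsSquare x then 1 else -1

open Polynomial

theorem euclideanDual_eq_self_of_le {F : Type*} [Field F] {n : ℕ}
    (C : Submodule F (Fin n → F)) (hC : C ≤ euclideanDual C)
    (hdim : 2 * Module.finrank F C = n) : C = euclideanDual C := by
  let B : LinearMap.BilinForm F (Fin n → F) := dotProductBilin F F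
  have hrefl : B.IsRefl := fun x y h => by
    change y ⬝ᵥ x = 0
    rw [dotProduct_comm]
    exact h
  have horth : B.orthogonal C = euclideanDual C := by
    ext x
    refine forall₂_congr fun c _ => ?_
    change c ⬝ᵥ x = 0 ↔ x ⬝ᵥ c = 0
    rw [dotProduct_comm]
  have htop : B.orthogonal ⊤ = ⊥ := by
    refine (Submodule.eq_bot_iff _).2 fun x hx => dotProduct_eq_zero x fun w => ?_
    rw [dotProduct_comm]
    exact hx w trivial
  have h := LinearMap.BilinForm.finrank_add_finrank_orthogonal hrefl C
  rw [htop, inf_bot_eq, finrank_bot, horth, Module.finrank_fin_fun] at h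
  exact Submodule.eq_of_le_of_finrank_eq hC (by omega)

theorem hWeight_add_card_zeros {F : Type*} [Field F] [DecidableEq F] {n : ℕ} (c : Fin n → F) :
    hWeight c + #{i | c i = 0} = n := by
  have h : hWeight c = #{i | c i ≠ 0} := by
    rw [hWeight, Nat.card_eq_fintype_card, Fintype.card_subtype]
  have h2 := Finset.card_filter_add_card_filter_not (s := (univ : Finset (Fin n)))
    (fun i => c i = 0)
  rw [Finset.card_univ, Fintype.card_fin] at h2
  simp only [ne_eq] at h
  omega

/-- The encoding map of the extended generalized Reed-Solomon code with evaluation points `a`,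
column multipliers `v`, and the coefficient of `X ^ d` in the coordinate `0`. -/
def extendedGRS {F : Type*} [Field F] (d : ℕ) {M : ℕ} (a v : Fin M → F) :
    F[X] →ₗ[F] (Fin (M + 1) → F) where
  toFun f := Fin.cons (f.coeff d) fun i => v i * f.eval (a i)
  map_add' f g := by
    ext i
    refine Fin.cases ?_ (fun i => ?_) i <;> simp [mul_add]
  map_smul' c f := by
    ext i
    refine Fin.cases ?_ (fun i => ?_) i <;> simp [mul_left_comm]

section

variable {F : Type*} [Field F] {d M : ℕ} {a v : Fin M → F}

@[simp]
theorem extendedGRS_zero (f : F[X]) : extendedGRS d a v f 0 = f.coeff d := rfl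

@[simp]
theorem extendedGRS_succ (f : F[X]) (i : Fin M) :
    extendedGRS d a v f i.succ = v i * f.eval (a i) := rfl

theorem card_zeros_extendedGRS_le [DecidableEq F] (ha : Function.Injective a)
    (hv : ∀ i, v i ≠ 0) {f : F[X]} (hf : f.natDegree ≤ d) (hf0 : f ≠ 0) :
    #{i | extendedGRS d a v f i = 0} ≤ d := by
  have hroots : #{i | f.eval (a i) = 0} ≤ f.natDegree := by
    rw [← Finset.card_image_of_injective _ ha]
    refine le_trans (Finset.card_le_card fun x hx => ?_)
      ((Multiset.toFinset_card_le _).trans f.card_roots')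
    simp only [mem_image, mem_filter, mem_univ, true_and] at hx
    obtain ⟨i, hi, rfl⟩ := hx
    simpa [hf0] using hi
  rw [Fin.card_filter_univ_succ]
  simp only [extendedGRS_zero, extendedGRS_succ, mul_eq_zero, hv, false_or]
  split_ifs with h
  · have : f.natDegree ≠ d := by
      rintro rfl
      exact hf0 (leadingCoeff_eq_zero.1 h)
    omega
  · omega

theorem sum_mul_extendedGRS {a v : Fin (2 * d + 1) → F} (ha : Function.Injective a)
    (h : ∀ i, v i ^ 2 * ∏ j ∈ univ.erase i, (a i - a j) = -1) {f g : F[X]}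
    (hf : f.natDegree ≤ d) (hg : g.natDegree ≤ d) :
    ∑ i, extendedGRS d a v f i * extendedGRS d a v g i = 0 := by
  have hdeg : (f * g).degree < #(univ : Finset (Fin (2 * d + 1))) := by
    rw [Finset.card_univ, Fintype.card_fin]
    refine (degree_le_natDegree).trans_lt (Nat.cast_lt.2 ?_)
    have := natDegree_mul_le (p := f) (q := g)
    omega
  have hsum := Lagrange.coeff_eq_sum ha.injOn hdeg
  rw [Finset.card_univ, Fintype.card_fin, Nat.add_sub_cancel,
    show (f * g).coeff (2 * d) = f.coeff d * g.coeff d by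
      rw [two_mul, coeff_mul_add_eq_of_natDegree_le hf hg]] at hsum
  rw [Fin.sum_univ_succ]
  simp only [extendedGRS_zero, extendedGRS_succ]
  rw [hsum, ← Finset.sum_add_distrib]
  refine Finset.sum_eq_zero fun i _ => ?_
  have hi := h i
  have hne : ∏ j ∈ univ.erase i, (a i - a j) ≠ 0 := by
    intro h0
    simp [h0] at hi
  rw [eval_mul]
  field_simp
  linear_combination (f.eval (a i) * g.eval (a i)) * hi

theorem exists_isMDSSelfDual_of_nodes (a v : Fin (2 * d + 1) → F) (ha : Function.Injective a)
    (h : ∀ i, v i ^ 2 * ∏ j ∈ univ.erase i, (a i - a j) = -1) :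
    ∃ C : Submodule F (Fin (2 * d + 1 + 1) → F), IsMDSSelfDual C := by
  classical
  have hv : ∀ i, v i ≠ 0 := fun i h0 => by simpa [h0] using h i
  have hmem : ∀ f ∈ degreeLT F (d + 1), f.natDegree ≤ d := fun f hf =>
    natDegree_le_iff_degree_le.2 (mem_degreeLE.1 (by rwa [← degreeLT_succ_eq_degreeLE]))
  have hzeros {f : F[X]} (hf : f ∈ degreeLT F (d + 1)) (hf0 : f ≠ 0) :=
    card_zeros_extendedGRS_le (a := a) (v := v) ha hv (hmem f hf) hf0
  have hweight (f : F[X]) := hWeight_add_card_zeros (extendedGRS d a v f)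
  have hinj : Set.InjOn (extendedGRS d a v) (degreeLT F (d + 1)) := by
    intro f hf g hg hfg
    by_contra hne
    have hz := hzeros (Submodule.sub_mem _ hf hg) (sub_ne_zero.2 hne)
    simp only [map_sub, hfg, sub_self, Pi.zero_apply, Finset.filter_true, Finset.card_univ,
      Fintype.card_fin] at hz
    omega
  refine ⟨(degreeLT F (d + 1)).map (extendedGRS d a v), ?_, ?_, ?_⟩
  · refine euclideanDual_eq_self_of_le _ ?_ ?_
    · rintro _ ⟨f, hf, rfl⟩ _ ⟨g, hg, rfl⟩
      exact sum_mul_extendedGRS ha h (hmem f hf) (hmem g hg)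
    · rw [← LinearMap.range_domRestrict, LinearMap.finrank_range_of_inj,
        (degreeLTEquiv F (d + 1)).finrank_eq, Module.finrank_fin_fun]
      · ring
      · exact fun x y hxy => Subtype.ext (hinj x.2 y.2 hxy)
  · rintro _ ⟨f, hf, rfl⟩ hne
    have hf0 : f ≠ 0 := by
      rintro rfl
      simp at hne
    have hz := hzeros hf hf0
    have hw := hweight f
    omega
  · obtain ⟨s, -, hs⟩ := Finset.exists_subset_card_eq
      (s := (univ : Finset (Fin (2 * d + 1)))) (n := d) (by simp; omega)
    have hf : Lagrange.nodal s a ∈ degreeLT F (d + 1) := by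
      rw [mem_degreeLT, Lagrange.degree_nodal, hs]
      exact_mod_cast Nat.lt_succ_self d
    have hf0 : Lagrange.nodal s a ≠ 0 := Lagrange.nodal_ne_zero
    have hz := hzeros hf hf0
    have hw := hweight (Lagrange.nodal s a)
    have hz' : d ≤ #{i | extendedGRS d a v (Lagrange.nodal s a) i = 0} := by
      refine (hs.symm.trans (Finset.card_map (Fin.succEmb _)).symm).trans_le
        (Finset.card_le_card fun x hx => ?_)
      obtain ⟨i, hi, rfl⟩ := Finset.mem_map.1 hx
      simp [Lagrange.eval_nodal_at_node hi]
    refine ⟨_, ⟨_, hf, rfl⟩, fun h0 => ?_, by omega⟩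
    exact hf0 (hinj hf (Submodule.zero_mem _) (by rw [h0, map_zero]))

end

theorem exists_isMDSSelfDual_of_monic {F : Type*} [Field F] {n : ℕ} (hn : Odd n) (A : Finset F)
    (hA : #A = n) (f : F[X]) (hf : f.Monic) (hdeg : f.natDegree = n)
    (hroot : ∀ x ∈ A, f.eval x = 0)
    (hsq : ∀ x ∈ A, f.derivative.eval x ≠ 0 ∧ IsSquare (-f.derivative.eval x)) :
    ∃ C : Submodule F (Fin (n + 1) → F), IsMDSSelfDual C := by
  classical
  obtain ⟨d, rfl⟩ := hn
  let e : Fin (2 * d + 1) ≃ A := (Finset.equivFinOfCardEq hA).symm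
  let a : Fin (2 * d + 1) → F := fun i => e i
  have ha : Function.Injective a := Subtype.val_injective.comp e.injective
  have hnodal : f = Lagrange.nodal univ a := by
    refine eq_of_degree_sub_lt_of_eval_index_eq univ ha.injOn ?_ fun i hi => ?_
    · have hd : f.degree = #(univ : Finset (Fin (2 * d + 1))) := by
        rw [degree_eq_natDegree hf.ne_zero, hdeg, Finset.card_univ, Fintype.card_fin]
      rw [← hd]
      exact degree_sub_lt_left (by rw [hd, Lagrange.degree_nodal]) hf.ne_zero
        (by rw [hf.leadingCoeff, Lagrange.nodal_monic.leadingCoeff])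
    · rw [hroot _ (e i).2, Lagrange.eval_nodal_at_node hi]
  have hder (i) : f.derivative.eval (a i) = ∏ j ∈ univ.erase i, (a i - a j) := by
    rw [hnodal, Lagrange.eval_nodal_derivative_eval_node_eq (mem_univ i), Lagrange.eval_nodal]
  choose y hy using fun i => (hsq _ (e i).2).2
  refine exists_isMDSSelfDual_of_nodes a (fun i => (y i)⁻¹) ha fun i => ?_
  rw [← hder i]
  have hne := (hsq _ (e i).2).1
  have hyi := hy i
  have hy0 : y i ≠ 0 := by
    intro h0
    rw [h0, mul_zero, neg_eq_zero] at hyi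
    exact hne hyi
  change _ * f.derivative.eval (e i : F) = -1
  rw [neg_eq_iff_eq_neg.1 hyi]
  field_simp

theorem prod_eq_neg_one_pow_mul_sq {F : Type*} [Field F] (h2 : (2 : F) ≠ 0) (S : Finset F)
    (hneg : ∀ x ∈ S, -x ∈ S) (h0 : (0 : F) ∉ S) :
    ∃ y : F, ∏ x ∈ S, x = (-1) ^ (#S / 2) * y ^ 2 := by
  classical
  induction S using Finset.strongInduction with
  | H S ih =>
    rcases S.eq_empty_or_nonempty with rfl | ⟨x, hx⟩
    · exact ⟨1, by simp⟩
    have hx0 : x ≠ 0 := fun h => h0 (h ▸ hx)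
    have hxn : -x ≠ x := fun h => by
      have : (2 : F) * x = 0 := by linear_combination -h
      simp_all
    have hx' : -x ∈ S.erase x := mem_erase.2 ⟨hxn, hneg x hx⟩
    obtain ⟨y, hy⟩ := ih ((S.erase x).erase (-x))
      ((erase_ssubset hx').trans (erase_ssubset hx))
      (fun z hz => by
        simp only [mem_erase, ne_eq, neg_inj] at hz ⊢
        exact ⟨hz.2.1, fun h => hz.1 (by rw [← h, neg_neg]), hneg z hz.2.2⟩)
      (fun h => h0 (mem_of_mem_erase (mem_of_mem_erase h)))
    have hcard : #S / 2 = #((S.erase x).erase (-x)) / 2 + 1 := by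
      have h1 := card_erase_add_one hx
      have h3 := card_erase_add_one hx'
      omega
    refine ⟨x * y, ?_⟩
    rw [← mul_prod_erase S _ hx, ← mul_prod_erase _ _ hx', hy, hcard]
    ring

section

variable {F : Type*} [Field F] {S : Finset F}

theorem nodal_comp_X_add_C (hS0 : (0 : F) ∈ S) (hsub : ∀ x ∈ S, ∀ y ∈ S, x - y ∈ S) (y : F) :
    (Lagrange.nodal S id).comp (X + C y) =
      Lagrange.nodal S id + C ((Lagrange.nodal S id).eval y) := by
  set L := Lagrange.nodal S id with hL
  have hmonic : L.Monic := Lagrange.nodal_monic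
  have hdeg : L.degree = #S := Lagrange.degree_nodal
  have hpos : 0 < #S := card_pos.2 ⟨0, hS0⟩
  have hnat : L.natDegree = #S := Lagrange.natDegree_nodal
  have hmonic' : (L.comp (X + C y)).Monic := hmonic.comp_X_add_C y
  have hdeg' : (L.comp (X + C y)).degree = #S := by
    rw [degree_eq_natDegree hmonic'.ne_zero, natDegree_comp, natDegree_X_add_C, mul_one, hnat]
  rw [← sub_eq_iff_eq_add', ← sub_eq_zero]
  refine eq_zero_of_degree_lt_of_eval_finset_eq_zero S ?_ fun h hh => ?_
  · refine (degree_sub_le _ _).trans_lt (max_lt ?_ ?_)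
    · rw [← hdeg']
      exact degree_sub_lt_left (by rw [hdeg, hdeg']) hmonic'.ne_zero
        (by rw [hmonic.leadingCoeff, hmonic'.leadingCoeff])
    · exact degree_C_le.trans_lt (by exact_mod_cast hpos)
  · have hroot : L.eval h = 0 := Lagrange.eval_nodal_at_node (v := id) hh
    have hshift : L.eval (h + y) = L.eval y := by
      rw [hL, Lagrange.eval_nodal, Lagrange.eval_nodal]
      refine Finset.prod_bij' (fun x _ => x - h) (fun x _ => x + h) (fun x hx => hsub x hx h hh)
        (fun x hx => ?_) (by simp) (by simp) (fun x _ => by simp only [id]; ring)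
      have := hsub x hx _ (hsub 0 hS0 h hh)
      simpa using this
    simp [hroot, hshift]

theorem eval_derivative_nodal_eq_eval_zero (hS0 : (0 : F) ∈ S) (hsub : ∀ x ∈ S, ∀ y ∈ S, x - y ∈ S)
    (y : F) :
    (Lagrange.nodal S id).derivative.eval y = (Lagrange.nodal S id).derivative.eval 0 := by
  have h := congrArg (fun f => f.derivative.eval 0) (nodal_comp_X_add_C hS0 hsub y)
  simpa [derivative_comp] using h

theorem exists_derivative_nodal_eq (h2 : (2 : F) ≠ 0) (hodd : Odd #S) (hS0 : (0 : F) ∈ S)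
    (hsub : ∀ x ∈ S, ∀ y ∈ S, x - y ∈ S) :
    ∃ z : F, z ≠ 0 ∧ ∀ y, (Lagrange.nodal S id).derivative.eval y = (-1) ^ (#S / 2) * z ^ 2 := by
  classical
  have h0 : (Lagrange.nodal S id).derivative.eval 0 = ∏ x ∈ S.erase 0, x := by
    have h := Lagrange.eval_nodal_derivative_eval_node_eq (v := (id : F → F)) hS0
    rw [Lagrange.eval_nodal] at h
    refine h.trans ?_
    refine Finset.prod_bij' (fun x _ => -x) (fun x _ => -x) ?_ ?_ (by simp) (by simp) (by simp)
    all_goals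
      intro x hx
      simp only [mem_erase, ne_eq, neg_eq_zero] at hx ⊢
      exact ⟨hx.1, by simpa using hsub 0 hS0 x hx.2⟩
  obtain ⟨z, hz⟩ := prod_eq_neg_one_pow_mul_sq h2 (S.erase 0)
    (fun x hx => by
      simp only [mem_erase, ne_eq, neg_eq_zero] at hx ⊢
      exact ⟨hx.1, by simpa using hsub 0 hS0 x hx.2⟩) (by simp)
  have hcard : #(S.erase 0) / 2 = #S / 2 := by
    have := card_erase_add_one hS0
    obtain ⟨c, hc⟩ := hodd
    omega
  refine ⟨z, ?_, fun y => by rw [eval_derivative_nodal_eq_eval_zero hS0 hsub, h0, hz, hcard]⟩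
  rintro rfl
  have hne : ∏ x ∈ S.erase 0, x ≠ 0 := prod_ne_zero_iff.2 fun x hx => (mem_erase.1 hx).1
  simp [hz] at hne

theorem eval_mul_nodal_pow {t : ℕ} {ω : F} (hω : ω ^ t = 1) (ht : t ≠ 0)
    (hmul : ∀ ζ : F, ζ ^ t = 1 → ∀ h ∈ S, ζ * h ∈ S) (v : F) :
    (Lagrange.nodal S id).eval (ω * v) ^ t = (Lagrange.nodal S id).eval v ^ t := by
  have hω0 : ω ≠ 0 := by
    rintro rfl
    simp [ht] at hω
  have h : (Lagrange.nodal S id).eval (ω * v) = ω ^ #S * (Lagrange.nodal S id).eval v := by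
    rw [Lagrange.eval_nodal, Lagrange.eval_nodal, ← Finset.prod_const, ← Finset.prod_mul_distrib]
    refine Finset.prod_bij' (fun x _ => ω⁻¹ * x) (fun x _ => ω * x)
      (fun x hx => hmul _ (by rw [inv_pow, hω, inv_one]) x hx) (fun x hx => hmul _ hω x hx)
      (fun x _ => by field_simp) (fun x _ => by field_simp)
      (fun x _ => by simp only [id]; field_simp)
  rw [h, mul_pow, ← pow_mul, mul_comm #S, pow_mul, hω, one_pow, one_mul]

theorem exists_isMDSSelfDual_of_subgroup [Fintype F] [DecidableEq F] {t N : ℕ}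
    (hS0 : (0 : F) ∈ S) (hsub : ∀ x ∈ S, ∀ y ∈ S, x - y ∈ S) (hS : Odd #S) (ht : Odd t)
    (hN : Odd N) (hN1 : (N : F) = 1) (h2 : (2 : F) ≠ 0) (ht0 : (t : F) ≠ 0)
    (hsq : IsSquare ((-1 : F) ^ ((#S + 1) / 2) * t)) (hμ : #{ω : F | ω ^ t = 1} = t)
    (hmul : ∀ ζ : F, ζ ^ t = 1 → ∀ h ∈ S, ζ * h ∈ S) {v : F} (hvS : v ∉ S)
    (hv : ∀ ω ζ : F, ω ^ t = 1 → ζ ^ t = 1 → (ω - ζ) * v ∈ S → ω = ζ)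
    (hfib : ∀ ω : F, ω ^ t = 1 → ∀ h ∈ S, ω * v + h ≠ 0 → #{x : F | x ^ N = ω * v + h} = N) :
    ∃ C : Submodule F (Fin (t * #S * N + 1) → F), IsMDSSelfDual C := by
  have hlength : Odd (t * #S * N) := (ht.mul hS).mul hN
  have htpos := ht.pos
  have hNpos := hN.pos
  set L := Lagrange.nodal S id with hL
  have hLmonic : L.Monic := Lagrange.nodal_monic
  have hLnat : L.natDegree = #S := Lagrange.natDegree_nodal
  have hne : ∀ ω : F, ω ^ t = 1 → ∀ h ∈ S, ω * v + h ≠ 0 := by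
    intro ω hω h hh h0
    have hω0 : ω ≠ 0 := by
      rintro rfl
      simp [htpos.ne'] at hω
    have hmem := hmul ω⁻¹ (by rw [inv_pow, hω, inv_one]) _ (hsub 0 hS0 h hh)
    rw [show 0 - h = ω * v by linear_combination -h0, inv_mul_cancel_left₀ hω0] at hmem
    exact hvS hmem
  have hLadd : ∀ x y, L.eval (x + y) = L.eval x + L.eval y := fun x y => by
    simpa using congrArg (eval x) (nodal_comp_X_add_C hS0 hsub y)
  have hLB : ∀ ω : F, ω ^ t = 1 → ∀ h ∈ S, L.eval (ω * v + h) ^ t = L.eval v ^ t := by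
    intro ω hω h hh
    have hroot : L.eval h = 0 := Lagrange.eval_nodal_at_node (v := id) hh
    rw [hLadd, hroot, add_zero, eval_mul_nodal_pow hω htpos.ne' hmul]
  have hLv : L.eval v ≠ 0 := by
    rw [hL, Lagrange.eval_nodal, prod_ne_zero_iff]
    exact fun x hx h => hvS (by rwa [sub_eq_zero.1 h])
  let B : Finset F := image₂ (fun ω h => ω * v + h) {ω : F | ω ^ t = 1} S
  have hBmem : ∀ b ∈ B, ∃ ω : F, ω ^ t = 1 ∧ ∃ h ∈ S, ω * v + h = b := by
    intro b hb
    simpa [B, mem_image₂] using hb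
  have hBcard : #B = t * #S := by
    have hinj : Set.InjOn (fun x : F × F => x.1 * v + x.2)
        ((({ω : F | ω ^ t = 1} : Finset F) : Set F) ×ˢ (S : Set F)) := by
      rintro ⟨ω, h⟩ hωh ⟨ζ, h'⟩ hζh heq
      simp only [Set.mem_prod, mem_coe, mem_filter, mem_univ, true_and] at hωh hζh heq
      have hωζ := hv ω ζ hωh.1 hζh.1
        (by rw [show (ω - ζ) * v = h' - h by linear_combination heq]
            exact hsub _ hζh.2 _ hωh.2)
      subst hωζ
      simpa using heq
    rw [card_image₂_iff.2 hinj, hμ]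
  let A : Finset F := {x | x ^ N ∈ B}
  have hAcard : #A = t * #S * N := by
    rw [Finset.card_eq_sum_card_fiberwise (f := fun x => x ^ N) (t := B)
      (fun x hx => by simpa [A] using hx), ← hBcard]
    refine Finset.sum_const_nat fun b hb => ?_
    obtain ⟨ω, hω, h, hh, rfl⟩ := hBmem b hb
    refine Eq.trans (congrArg card ?_) (hfib ω hω h hh (hne ω hω h hh))
    ext x
    simp only [A, mem_filter, mem_univ, true_and, and_iff_right_iff_imp]
    intro hx
    rwa [hx]
  let g : F[X] := L ^ t - C (L.eval v ^ t)
  have hgdeg : (C (L.eval v ^ t)).degree < (L ^ t).degree := by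
    refine degree_C_le.trans_lt ?_
    rw [← natDegree_pos_iff_degree_pos, natDegree_pow, hLnat]
    exact Nat.mul_pos htpos hS.pos
  have hgmonic : g.Monic := (hLmonic.pow t).sub_of_left hgdeg
  have hgnat : g.natDegree = t * #S := by
    rw [natDegree_sub_C, natDegree_pow, hLnat]
  obtain ⟨z, hz0, hz⟩ := exists_derivative_nodal_eq h2 hS hS0 hsub
  obtain ⟨i, hi⟩ := ht
  obtain ⟨j, hj⟩ := hN
  obtain ⟨c, hc⟩ := hS
  refine exists_isMDSSelfDual_of_monic hlength A hAcard (g.comp (X ^ N))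
    (hgmonic.comp (monic_X_pow N) (by rw [natDegree_X_pow]; exact hNpos.ne'))
    (by rw [natDegree_comp, natDegree_X_pow, hgnat]) (fun x hx => ?_) fun x hx => ?_
  · obtain ⟨ω, hω, h, hh, hb⟩ := hBmem _ (mem_filter.1 hx).2
    simp [g, ← hb, hLB ω hω h hh]
  · obtain ⟨ω, hω, h, hh, hb⟩ := hBmem _ (mem_filter.1 hx).2
    have hLx : L.eval (x ^ N) ≠ 0 := fun h0 => by
      have h1 := hLB ω hω h hh
      rw [hb, h0, zero_pow htpos.ne'] at h1
      exact pow_ne_zero t hLv h1.symm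
    have hx0 : x ≠ 0 := by
      rintro rfl
      exact hne ω hω h hh (by rw [hb, zero_pow hNpos.ne'])
    have hder : (g.comp (X ^ N)).derivative.eval x =
        (-1) ^ (#S / 2) * t * (x ^ j * L.eval (x ^ N) ^ i * z) ^ 2 := by
      have h1 : (g.comp (X ^ N)).derivative.eval x = N * x ^ (N - 1) *
          (t * L.eval (x ^ N) ^ (t - 1) * L.derivative.eval (x ^ N)) := by
        simp [g, derivative_comp, derivative_pow, mul_comm, mul_left_comm]
      rw [h1, hz, hN1, show N - 1 = 2 * j by omega, show t - 1 = 2 * i by omega]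
      ring
    rw [hder]
    refine ⟨by simp [ht0, hx0, hLx, hz0], ?_⟩
    have hneg : -((-1) ^ (#S / 2) * t * (x ^ j * L.eval (x ^ N) ^ i * z) ^ 2) =
        ((-1) ^ ((#S + 1) / 2) * t) * (x ^ j * L.eval (x ^ N) ^ i * z) ^ 2 := by
      rw [show (#S + 1) / 2 = #S / 2 + 1 by omega]
      ring
    rw [hneg]
    exact hsq.mul (IsSquare.sq _)

end

section

variable {F : Type*} [Field F] [Fintype F] [DecidableEq F]

theorem card_filter_pow_eq {n k : ℕ} (hn : n * k = Fintype.card F - 1) {b : F} (hb : b ^ k = 1) :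
    #{x : F | x ^ n = b} = n := by
  have hcard := Fintype.one_lt_card (α := F)
  have hnpos : 0 < n := Nat.pos_of_ne_zero fun h => by simp [h] at hn; omega
  have hdvd : (X ^ n - C b : F[X]) ∣ X ^ Fintype.card F - X := by
    have h : (X ^ n - C b : F[X]) ∣ X ^ (n * k) - 1 := by
      have h := sub_dvd_pow_sub_pow (X ^ n : F[X]) (C b) k
      rwa [← C_pow, hb, C_1, ← pow_mul] at h
    have hX : (X ^ Fintype.card F - X : F[X]) = (X ^ (n * k) - 1) * X := by
      rw [sub_mul, one_mul, ← pow_succ, hn, Nat.sub_add_cancel hcard.le]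
    rw [hX]
    exact h.mul_right X
  have hne : (X ^ Fintype.card F - X : F[X]) ≠ 0 := FiniteField.X_pow_card_sub_X_ne_zero F hcard
  have hroots := FiniteField.roots_X_pow_card_sub_X F
  have hsplits : (X ^ n - C b : F[X]).Splits := by
    refine Splits.of_dvd ?_ hne hdvd
    rw [splits_iff_card_roots, hroots, FiniteField.X_pow_card_sub_X_natDegree_eq F hcard]
    rfl
  have hnodup : (X ^ n - C b : F[X]).roots.Nodup :=
    Multiset.nodup_of_le (hroots ▸ roots.le_of_dvd hne hdvd) univ.nodup
  have hset : ({x : F | x ^ n = b} : Finset F) = (X ^ n - C b : F[X]).roots.toFinset := by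
    ext x
    simp [X_pow_sub_C_ne_zero hnpos b, sub_eq_zero]
  rw [hset, Multiset.toFinset_card_of_nodup hnodup, ← hsplits.natDegree_eq_card_roots,
    natDegree_X_pow_sub_C]

theorem card_filter_pow_eq_self {n : ℕ} (h1 : 1 < n) (hn : n - 1 ∣ Fintype.card F - 1) :
    #{x : F | x ^ n = x} = n := by
  obtain ⟨k, hk⟩ := hn
  have hset : ({x : F | x ^ n = x} : Finset F) =
      insert 0 ({x : F | x ^ (n - 1) = 1} : Finset F) := by
    ext x
    obtain ⟨n, rfl⟩ : ∃ l, n = l + 1 := ⟨n - 1, by omega⟩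
    by_cases hx : x = 0
    · simp [hx]
    · simp [hx, pow_succ]
  rw [hset, card_insert_of_notMem, card_filter_pow_eq hk.symm (one_pow k)]
  · omega
  · simp [show n - 1 ≠ 0 by omega]

end

/-- The subfield `{x | x ^ p ^ k = x}` of a field of characteristic `p`. -/
def frobeniusFixedSubfield (F : Type*) [Field F] (p k : ℕ) [ExpChar F p] : Subfield F :=
  (iterateFrobenius F p k).eqLocusField (RingHom.id F)

theorem mem_frobeniusFixedSubfield {F : Type*} [Field F] {p k : ℕ} [ExpChar F p] {x : F} :
    x ∈ frobeniusFixedSubfield F p k ↔ x ^ p ^ k = x := by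
  rw [frobeniusFixedSubfield, RingHom.mem_eqLocusField, iterateFrobenius_def, RingHom.id_apply]

theorem pow_pow_eq_self {M : Type*} [Monoid M] {x : M} {r : ℕ} (hx : x ^ r = x) (s : ℕ) :
    x ^ r ^ s = x := by
  induction s with
  | zero => simp
  | succ s ih => rw [pow_succ, pow_mul, ih, hx]

/-- The subfield `{x | x ^ p ^ (k * s) = x}`, as a vector space over
the subfield `{x | x ^ p ^ k = x}`. -/
def frobeniusFixedSubmodule (F : Type*) [Field F] (p k s : ℕ) [ExpChar F p] :
    Submodule (frobeniusFixedSubfield F p k) F where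
  carrier := frobeniusFixedSubfield F p (k * s)
  add_mem' := add_mem
  zero_mem' := zero_mem _
  smul_mem' c x hx := by
    refine mul_mem (mem_frobeniusFixedSubfield.2 ?_) hx
    rw [pow_mul]
    exact pow_pow_eq_self (mem_frobeniusFixedSubfield.1 c.2) s

theorem mem_frobeniusFixedSubmodule {F : Type*} [Field F] {p k s : ℕ} [ExpChar F p] {x : F} :
    x ∈ frobeniusFixedSubmodule F p k s ↔ x ^ p ^ (k * s) = x :=
  mem_frobeniusFixedSubfield

theorem exists_submodule_finrank_eq {K V : Type*} [DivisionRing K] [AddCommGroup V] [Module K V]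
    (W : Submodule K V) [FiniteDimensional K W] {e : ℕ} (he : e < Module.finrank K W) :
    ∃ H ≤ W, Module.finrank K H = e ∧ ∃ v ∈ W, v ∉ H := by
  let b := Module.finBasis K W
  let w : Fin (Module.finrank K W) → V := fun i => b i
  have hw : LinearIndependent K w := b.linearIndependent.map' W.subtype W.ker_subtype
  let c : Fin e → Fin (Module.finrank K W) := Fin.castLE he.le
  refine ⟨Submodule.span K (Set.range (w ∘ c)), ?_, ?_, w ⟨e, he⟩, (b _).2, ?_⟩
  · rw [Submodule.span_le]
    rintro _ ⟨i, rfl⟩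
    exact (b _).2
  · rw [finrank_span_eq_card (hw.comp c (Fin.castLE_injective _)), Fintype.card_fin]
  · rw [Set.range_comp]
    refine hw.notMem_span_image ?_
    rintro ⟨i, hi⟩
    have := congrArg Fin.val hi
    have := i.2
    simp [c] at *
    omega

theorem stmt_10 (r s m e t p k : ℕ) (hp : p.Prime) (hpodd : Odd p) (hr : r = p ^ k)
    (hk : 0 < k) (hs : 0 < s) (hm : Odd m) (hm0 : 0 < m)
    (ht : Odd t) (hdvd : t ∣ r - 1) (he : e ≤ s - 1)
    (F : Type*) [Field F] [Fintype F] (hF : Fintype.card F = r ^ (s * m))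
    (hchi : quadChar F ((-1 : F) ^ ((r ^ e + 1) / 2) * ((t : ℕ) : F)) = 1) :
    ∃ C : Submodule F (Fin (t * r ^ e * (∑ i ∈ Finset.range m, r ^ (s * i)) + 1) → F),
      IsMDSSelfDual C := by
  classical
  have : Fact p.Prime := ⟨hp⟩
  have hp1 := hp.one_lt
  have hr1 : 1 < r := hr ▸ Nat.one_lt_pow hk.ne' hp1
  have hrodd : Odd r := hr ▸ hpodd.pow
  have hQ1 : 1 < r ^ s := Nat.one_lt_pow hs.ne' hr1
  have : CharP F p := charP_of_card_eq_prime_pow (f := k * (s * m)) (by rw [hF, hr, ← pow_mul])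
  set N := ∑ i ∈ Finset.range m, r ^ (s * i) with hN
  have hNQ : N * (r ^ s - 1) = Fintype.card F - 1 := by
    rw [hF, pow_mul, hN]
    simp only [pow_mul]
    exact geom_sum_mul_of_one_le hQ1.le m
  have hrdvd : r - 1 ∣ r ^ s - 1 := by simpa using Nat.sub_dvd_pow_sub_pow r 1 s
  have hQdvd : r ^ s - 1 ∣ Fintype.card F - 1 := ⟨N, by rw [← hNQ, mul_comm]⟩
  have hcast : (r : F) = 0 := by
    rw [hr, Nat.cast_pow, CharP.cast_eq_zero, zero_pow hk.ne']
  have hN1 : (N : F) = 1 := by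
    rw [hN, Nat.cast_sum, Finset.sum_eq_single_of_mem 0 (Finset.mem_range.2 hm0)]
    · simp
    · intro i _ hi
      rw [Nat.cast_pow, hcast, zero_pow (Nat.mul_ne_zero hs.ne' hi)]
  have hNodd : Odd N := by
    rw [hN, Finset.odd_sum_iff_odd_card_odd, Finset.filter_true_of_mem fun i _ => hrodd.pow,
      Finset.card_range]
    exact hm
  have h2 : (2 : F) ≠ 0 := by
    refine Ring.two_ne_zero ?_
    rw [ringChar.eq F p]
    rintro rfl
    exact absurd hpodd (by decide)
  have hne : (-1 : F) ^ ((r ^ e + 1) / 2) * t ≠ 0 := fun h => by simp [quadChar, h] at hchi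
  have hsq : IsSquare ((-1 : F) ^ ((r ^ e + 1) / 2) * t) := by
    by_contra h
    rw [quadChar, if_neg hne, if_neg h] at hchi
    exact absurd hchi (by decide)
  let K := frobeniusFixedSubfield F p k
  let W := frobeniusFixedSubmodule F p k s
  have hKmem {x : F} : x ∈ K ↔ x ^ r = x := by rw [hr]; exact mem_frobeniusFixedSubfield
  have hWmem {x : F} : x ∈ W ↔ x ^ r ^ s = x := by
    rw [hr, ← pow_mul]; exact mem_frobeniusFixedSubmodule
  have hK : Nat.card K = r :=
    (Nat.subtype_card _ fun x => by simp [hKmem]).trans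
      (card_filter_pow_eq_self hr1 (hrdvd.trans hQdvd))
  have hW : Nat.card W = r ^ s :=
    (Nat.subtype_card _ fun x => by simp [hWmem]).trans (card_filter_pow_eq_self hQ1 hQdvd)
  have hfin : Module.finrank K W = s := by
    rw [Module.natCard_eq_pow_finrank (K := K), hK] at hW
    exact Nat.pow_right_injective hr1 hW
  obtain ⟨H, hHW, hH, v, hvW, hvH⟩ := exists_submodule_finrank_eq W (e := e)
    (lt_of_lt_of_eq (by omega) hfin.symm)
  have hμK {ω : F} (hω : ω ^ t = 1) : ω ∈ K := by
    obtain ⟨l, hl⟩ := hdvd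
    rw [hKmem, ← Nat.sub_add_cancel hr1.le, pow_succ, hl, pow_mul, hω, one_pow, one_mul]
  let S : Finset F := {x | x ∈ H}
  have hSmem {x : F} : x ∈ S ↔ x ∈ H := by simp [S]
  have hS : #S = r ^ e := by
    rw [← Nat.subtype_card S fun x => hSmem]
    rw [Module.natCard_eq_pow_finrank (K := K), hK]
    exact congrArg _ hH
  have hmulW {ω : F} (hω : ω ^ t = 1) {x : F} (hx : x ∈ W) : ω * x ∈ W :=
    W.smul_mem ⟨ω, hμK hω⟩ hx
  have htcard : t ∣ Fintype.card F - 1 := hdvd.trans (hrdvd.trans hQdvd)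
  rw [← hS]
  refine exists_isMDSSelfDual_of_subgroup (v := v) (hSmem.2 H.zero_mem)
    (fun x hx y hy => hSmem.2 (H.sub_mem (hSmem.1 hx) (hSmem.1 hy))) (hS ▸ hrodd.pow) ht hNodd
    hN1 h2 (right_ne_zero_of_mul hne) (hS ▸ hsq) ?_ ?_ (fun h => hvH (hSmem.1 h)) ?_ ?_
  · obtain ⟨l, hl⟩ := htcard
    exact card_filter_pow_eq hl.symm (one_pow l)
  · exact fun ζ hζ h hh => hSmem.2 (H.smul_mem ⟨ζ, hμK hζ⟩ (hSmem.1 hh))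
  · intro ω ζ hω hζ h
    by_contra hωζ
    let c : K := ⟨ω - ζ, K.sub_mem (hμK hω) (hμK hζ)⟩
    have hc : c ≠ 0 := fun h0 => hωζ (sub_eq_zero.1 (congrArg Subtype.val h0))
    exact hvH ((H.smul_mem_iff hc).1 (hSmem.1 h))
  · intro ω hω h hh hb0
    refine card_filter_pow_eq hNQ ?_
    have hmem := hWmem.1 (W.add_mem (hmulW hω hvW) (hHW (hSmem.1 hh)))
    rw [← Nat.sub_add_cancel hQ1.le, pow_succ] at hmem
    exact mul_right_cancel₀ hb0 (hmem.trans (one_mul _).symm)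
end

section
/- Let q be an odd prime power with q − 1 = e_1·f_1 = e_2·f_2, let θ be a primitive element of F_q^*, and set β = θ^{e_2}. Let t be an even positive integer and let i_1, …, i_t be integers such that the elements α_μ = β^{i_μ f_1^2} of ⟨θ^{e_2 f_1^2}⟩ are pairwise distinct. Suppose that the values η(L_a(α_μ)) are equal for all 1 ≤ μ ≤ t, where L_a(α_μ) = ∏_{λ ≠ μ} (α_μ − α_λ). If e_1 is even, then there exists an MDS self-dual code over F_q of length t·f_1. -/
open Finset

open Polynomial in
/-- The generalized Reed–Solomon code of dimension `m` with evaluation points `x` and column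
multipliers `v`. -/
noncomputable def grsCode {F : Type*} [Field F] {n : ℕ} (x v : Fin n → F) (m : ℕ) :
    Submodule F (Fin n → F) :=
  (degreeLT F m).map (LinearMap.pi fun i => v i • leval (x i))

section GRS

open Polynomial

variable {F : Type*} [Field F] {n m : ℕ} {x v : Fin n → F}

theorem mem_grsCode {y : Fin n → F} :
    y ∈ grsCode x v m ↔ ∃ f : F[X], f.degree < m ∧ ∀ i, y i = v i * f.eval (x i) := by
  simp only [grsCode, Submodule.mem_map, mem_degreeLT, funext_iff]
  simp [leval, eq_comm]

theorem hWeight_eq_sub {y : Fin n → F} [DecidableEq F] :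
    hWeight y = n - #{i | y i = 0} := by
  have h := card_filter_add_card_filter_not (s := (univ : Finset (Fin n))) (fun i => y i = 0)
  have h' : hWeight y = #{i | ¬ y i = 0} := by
    rw [hWeight, Nat.card_eq_fintype_card, Fintype.card_subtype]
  rw [card_univ, Fintype.card_fin] at h
  omega

/-- The Euclidean product of two GRS words is a single coefficient of the product polynomial. -/
theorem sum_grs_mul_eq_coeff (hx : Function.Injective x) {c : F}
    (hc : ∀ i, v i ^ 2 * ∏ j ∈ univ.erase i, (x i - x j) = c) {f g : F[X]}
    (hfg : (f * g).degree < n) :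
    ∑ i, (v i * f.eval (x i)) * (v i * g.eval (x i)) = c * (f * g).coeff (n - 1) := by
  have h := Lagrange.coeff_eq_sum (s := univ) hx.injOn (P := f * g) (by simpa using hfg)
  rw [card_univ, Fintype.card_fin] at h
  rw [h, mul_sum]
  refine sum_congr rfl fun i _ => ?_
  have h0 : ∏ j ∈ univ.erase i, (x i - x j) ≠ 0 :=
    prod_ne_zero_iff.2 fun j hj => sub_ne_zero.2 (hx.ne (ne_of_mem_erase hj).symm)
  rw [← hc i, eval_mul]
  field_simp

theorem card_eval_eq_zero_lt (hx : Function.Injective x) [DecidableEq F] {f : F[X]} (hf : f ≠ 0)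
    (hdeg : f.degree < m) : #{i | f.eval (x i) = 0} < m := by
  by_contra! h
  refine hf (eq_zero_of_degree_lt_of_eval_index_eq_zero (v := x) {i | f.eval (x i) = 0} hx.injOn
    (hdeg.trans_le (by exact_mod_cast h)) fun i hi => (mem_filter.1 hi).2)

theorem grsCode_eq_euclideanDual (hx : Function.Injective x) (hn : n = 2 * m)
    (hv : ∀ i, v i ≠ 0) {c : F} (hc0 : c ≠ 0)
    (hc : ∀ i, v i ^ 2 * ∏ j ∈ univ.erase i, (x i - x j) = c) :
    grsCode x v m = euclideanDual (grsCode x v m) := by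
  ext y
  constructor
  · intro hy z hz
    obtain ⟨f, hf, hy⟩ := mem_grsCode.1 hy
    obtain ⟨g, hg, hz⟩ := mem_grsCode.1 hz
    simp only [hy, hz]
    rcases eq_or_ne f 0 with rfl | hf0
    · simp
    rcases eq_or_ne g 0 with rfl | hg0
    · simp
    have hf' := (natDegree_lt_iff_degree_lt hf0).2 hf
    have hg' := (natDegree_lt_iff_degree_lt hg0).2 hg
    have hfg := natDegree_mul hf0 hg0
    rw [sum_grs_mul_eq_coeff hx hc, coeff_eq_zero_of_natDegree_lt (by omega), mul_zero]
    exact (natDegree_lt_iff_degree_lt (mul_ne_zero hf0 hg0)).1 (by omega)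
  · intro hy
    set g := Lagrange.interpolate univ x fun i => y i / v i with hg
    have hyg : ∀ i, y i = v i * g.eval (x i) := fun i => by
      rw [hg, Lagrange.eval_interpolate_at_node _ hx.injOn (mem_univ i), mul_div_cancel₀ _ (hv i)]
    have hgn : g.degree < n := by
      simpa only [card_univ, Fintype.card_fin] using
        Lagrange.degree_interpolate_lt (s := univ) (fun i => y i / v i) hx.injOn
    refine mem_grsCode.2 ⟨g, ?_, hyg⟩
    rcases eq_or_ne g 0 with h0 | h0
    · rw [h0, degree_zero]
      exact WithBot.bot_lt_coe _
    rw [← natDegree_lt_iff_degree_lt h0] at hgn ⊢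
    by_contra! hm
    have hdeg : (g * X ^ (n - 1 - g.natDegree)).natDegree = n - 1 := by
      rw [natDegree_mul_X_pow _ h0]; omega
    have hne : g * X ^ (n - 1 - g.natDegree) ≠ 0 := mul_ne_zero h0 (pow_ne_zero _ X_ne_zero)
    have hs := hy (fun i => v i * (X ^ (n - 1 - g.natDegree) : F[X]).eval (x i))
      (mem_grsCode.2 ⟨_, by rw [degree_X_pow]; exact_mod_cast (by omega), fun _ => rfl⟩)
    simp only [hyg] at hs
    rw [sum_grs_mul_eq_coeff hx hc ((natDegree_lt_iff_degree_lt hne).1 (by omega))] at hs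
    refine mul_ne_zero hc0 ?_ hs
    nth_rw 2 [← hdeg]
    exact leadingCoeff_ne_zero.2 hne

theorem isMDSSelfDual_grsCode (hx : Function.Injective x) (hm : 0 < m) (hn : n = 2 * m)
    (hv : ∀ i, v i ≠ 0) {c : F} (hc0 : c ≠ 0)
    (hc : ∀ i, v i ^ 2 * ∏ j ∈ univ.erase i, (x i - x j) = c) :
    IsMDSSelfDual (grsCode x v m) := by
  classical
  have hwt : ∀ (y : Fin n → F) (f : F[X]), (∀ i, y i = v i * f.eval (x i)) →
      hWeight y = n - #{i | f.eval (x i) = 0} := fun y f hy => by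
    simp only [hWeight_eq_sub, hy, mul_eq_zero, hv, false_or]
  refine ⟨grsCode_eq_euclideanDual hx hn hv hc0 hc, ?_, ?_⟩
  · intro y hy hy0
    obtain ⟨f, hf, hy⟩ := mem_grsCode.1 hy
    have hf0 : f ≠ 0 := by
      rintro rfl
      exact hy0 (funext fun i => by simp [hy])
    have := card_eval_eq_zero_lt hx hf0 hf
    rw [hwt y f hy]
    omega
  · obtain ⟨s, -, hs⟩ := exists_subset_card_eq (s := (univ : Finset (Fin n))) (n := m - 1)
      (by rw [card_univ, Fintype.card_fin]; omega)
    have hz : ({i | (Lagrange.nodal s x).eval (x i) = 0} : Finset (Fin n)) = s := by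
      ext i
      simp [Lagrange.eval_nodal, prod_eq_zero_iff, sub_eq_zero, hx.eq_iff]
    have hw := hwt (fun i => v i * (Lagrange.nodal s x).eval (x i)) _ fun _ => rfl
    rw [hz, hs] at hw
    refine ⟨_, mem_grsCode.2 ⟨Lagrange.nodal s x, ?_, fun _ => rfl⟩, ?_, by rw [hw]; omega⟩
    · rw [Lagrange.degree_nodal, hs]
      exact_mod_cast (by omega : m - 1 < m)
    · intro h
      rw [h] at hw
      simp [hWeight] at hw
      omega

/-- If all the products of differences at the nodes agree up to squares, then the nodes carry an
MDS self-dual code. -/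
theorem exists_isMDSSelfDual_of_isSquare (hx : Function.Injective x) (hn0 : 0 < n) (hn : Even n)
    (hsq : ∀ i k, IsSquare ((∏ j ∈ univ.erase i, (x i - x j)) * ∏ j ∈ univ.erase k, (x k - x j))) :
    ∃ C : Submodule F (Fin n → F), IsMDSSelfDual C := by
  obtain ⟨m, hm⟩ := hn
  have h0 : ∀ i, ∏ j ∈ univ.erase i, (x i - x j) ≠ 0 := fun i =>
    prod_ne_zero_iff.2 fun j hj => sub_ne_zero.2 (hx.ne (ne_of_mem_erase hj).symm)
  choose r hr using fun i => hsq i ⟨0, hn0⟩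
  refine ⟨_, isMDSSelfDual_grsCode (m := m) (v := fun i => r i / ∏ j ∈ univ.erase i, (x i - x j))
    hx (by omega) (by omega) (fun i => div_ne_zero (fun h => ?_) (h0 i)) (h0 ⟨0, hn0⟩)
    fun i => ?_⟩
  · have := hr i
    rw [h, mul_zero] at this
    exact mul_ne_zero (h0 i) (h0 _) this
  · have := h0 i
    field_simp
    linear_combination -hr i

/-- If the nodes are roots of `∏ μ, (X ^ f - a μ)`, the product of differences at a node is the
derivative of that polynomial. -/
theorem prod_sub_eq_of_pow_eq {t f : ℕ} (hf : 0 < f) {x : Fin (t * f) → F}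
    (hx : Function.Injective x) {a : Fin t → F} {π : Fin (t * f) → Fin t}
    (hπ : ∀ i, x i ^ f = a (π i)) (i : Fin (t * f)) :
    ∏ j ∈ univ.erase i, (x i - x j) =
      f * x i ^ (f - 1) * ∏ μ ∈ univ.erase (π i), (a (π i) - a μ) := by
  set P : F[X] := ∏ μ, (X ^ f - C (a μ)) with hP
  have hmonic : P.Monic := monic_prod_of_monic _ _ fun μ _ => monic_X_pow_sub_C _ hf.ne'
  have hdeg : P.degree = (t * f : ℕ) := by
    rw [hP, degree_prod]
    simp [degree_X_pow_sub_C hf]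
  have hnodal : Lagrange.nodal univ x = P := by
    refine eq_of_degree_le_of_eval_index_eq (v := x) univ hx.injOn (by simp) ?_ ?_ fun k hk => ?_
    · rw [Lagrange.degree_nodal, hdeg, card_univ, Fintype.card_fin]
    · rw [Lagrange.nodal_monic.leadingCoeff, hmonic.leadingCoeff]
    · rw [Lagrange.eval_nodal_at_node hk, hP, eval_prod,
        prod_eq_zero (mem_univ (π k)) (by simp [hπ])]
  rw [← Lagrange.eval_nodal, ← Lagrange.eval_nodal_derivative_eval_node_eq (mem_univ i), hnodal, hP,
    ← mul_prod_erase univ _ (mem_univ (π i)), derivative_mul]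
  simp [eval_prod, hπ, derivative_X_pow]

end GRS

theorem isSquare_mul_of_quadChar_eq {F : Type*} [Field F] [Finite F] {a b : F} (ha : a ≠ 0)
    (hb : b ≠ 0) (h : quadChar F a = quadChar F b) : IsSquare (a * b) := by
  classical
  have := Fintype.ofFinite F
  have hab := mul_ne_zero ha hb
  rw [quadChar, quadChar, if_neg ha, if_neg hb] at h
  rw [← quadraticChar_one_iff_isSquare hab, map_mul]
  by_cases h1 : IsSquare a <;> by_cases h2 : IsSquare b
  · rw [(quadraticChar_one_iff_isSquare ha).2 h1, (quadraticChar_one_iff_isSquare hb).2 h2, mul_one]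
  · simp [h1, h2] at h
  · simp [h1, h2] at h
  · rw [quadraticChar_neg_one_iff_not_isSquare.2 h1, quadraticChar_neg_one_iff_not_isSquare.2 h2]
    norm_num

theorem stmt_14 (q e1 f1 e2 f2 t p k : ℕ) (hp : p.Prime) (hpodd : Odd p) (hq : q = p ^ k)
    (hk : 0 < k) (h1 : q - 1 = e1 * f1) (h2 : q - 1 = e2 * f2)
    (F : Type*) [Field F] [Fintype F] (hF : Fintype.card F = q)
    (θ : Fˣ) (hθ : ∀ x : Fˣ, x ∈ Subgroup.zpowers θ)
    (ht : Even t) (ht0 : 0 < t)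
    (idx : Fin t → ℤ)
    (α : Fin t → Fˣ) (hα : ∀ μ, α μ = (θ ^ e2) ^ (idx μ * (f1 : ℤ) ^ 2))
    (hαinj : Function.Injective α)
    (hL : ∀ μ ν : Fin t,
      quadChar F (∏ lam ∈ Finset.univ.erase μ, ((α μ : F) - (α lam : F))) =
      quadChar F (∏ lam ∈ Finset.univ.erase ν, ((α ν : F) - (α lam : F))))
    (he1 : Even e1) :
    ∃ C : Submodule F (Fin (t * f1) → F), IsMDSSelfDual C := by
  have hq1 : 1 < q := hq ▸ Nat.one_lt_pow hk.ne' hp.one_lt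
  have hf : 0 < f1 := Nat.pos_of_ne_zero fun h => by simp [h] at h1; omega
  have hθo : orderOf θ = e1 * f1 := by
    rw [orderOf_eq_card_of_forall_mem_zpowers hθ, Nat.card_units, Nat.card_eq_fintype_card, hF, h1]
  have he0 : e1 ≠ 0 := by
    rintro rfl
    omega
  have hζ : orderOf (θ ^ e1) = f1 := by
    rw [orderOf_pow_of_dvd he0 (hθo ▸ dvd_mul_right _ _), hθo,
      Nat.mul_div_cancel_left _ (Nat.pos_of_ne_zero he0)]
  let u : Fin t × Fin f1 → Fˣ := fun z => (θ ^ e2) ^ (idx z.1 * (f1 : ℤ)) * (θ ^ e1) ^ (z.2 : ℕ)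
  have hupow : ∀ z, u z ^ f1 = α z.1 := fun z => by
    have h : ((θ ^ e1) ^ (z.2 : ℕ)) ^ f1 = 1 := by
      rw [pow_right_comm, orderOf_dvd_iff_pow_eq_one.1 hζ.dvd, one_pow]
    rw [mul_pow, h, mul_one, hα, ← zpow_natCast, ← zpow_mul]
    ring_nf
  have huinj : Function.Injective u := by
    rintro ⟨μ, j⟩ ⟨ν, l⟩ h
    obtain rfl : μ = ν := hαinj (by rw [← hupow (μ, j), ← hupow (ν, l), h])
    have hjl : (θ ^ e1) ^ (j : ℕ) = (θ ^ e1) ^ (l : ℕ) := mul_left_cancel h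
    have := pow_injOn_Iio_orderOf (x := θ ^ e1) (by simp [hζ]) (by simp [hζ]) hjl
    rw [Fin.ext this]
  have husq : ∀ z, IsSquare (u z ^ (f1 - 1)) := fun z => by
    have hev : Even (f1 * (f1 - 1)) := Nat.even_mul_pred_self f1
    have h : u z ^ (f1 - 1) = ((θ ^ e2) ^ idx z.1) ^ (f1 * (f1 - 1)) *
        (θ ^ e1) ^ ((z.2 : ℕ) * (f1 - 1)) := by
      rw [mul_pow, zpow_mul, zpow_natCast, ← pow_mul, ← pow_mul]
    rw [h, pow_mul (θ ^ e1)]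
    exact (hev.isSquare_pow _).mul (((he1.isSquare_pow θ).pow _).pow _)
  have hxinj : Function.Injective fun i => (u (finProdFinEquiv.symm i) : F) :=
    Units.val_injective.comp (huinj.comp finProdFinEquiv.symm.injective)
  have hdiff := prod_sub_eq_of_pow_eq hf hxinj (a := fun μ => (α μ : F))
    (π := fun i => (finProdFinEquiv.symm i).1) fun i => by
      rw [← Units.val_pow_eq_pow_val, hupow]
  refine exists_isMDSSelfDual_of_isSquare hxinj (Nat.mul_pos ht0 hf) (ht.mul_right _) fun i l => ?_
  have hL0 : ∀ μ, ∏ lam ∈ univ.erase μ, ((α μ : F) - (α lam : F)) ≠ 0 := fun μ =>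
    prod_ne_zero_iff.2 fun lam h => sub_ne_zero.2
      ((Units.val_injective.comp hαinj).ne (ne_of_mem_erase h).symm)
  have hsq : ∀ z, IsSquare ((u z : F) ^ (f1 - 1)) := fun z => by
    have := (husq z).map (Units.coeHom F)
    rwa [map_pow] at this
  have := ((IsSquare.mul_self (f1 : F)).mul ((hsq (finProdFinEquiv.symm i)).mul
    (hsq (finProdFinEquiv.symm l)))).mul (isSquare_mul_of_quadChar_eq (hL0 _) (hL0 _)
    (hL (finProdFinEquiv.symm i).1 (finProdFinEquiv.symm l).1))
  simp only [hdiff]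
  refine Eq.mp (congrArg IsSquare ?_) this
  ring
end
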